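/- arXiv:1809.10202 — 2 statements merged into one kernel-verified Lean document; each statement's English description precedes it below -/
import Mathlib

section
/- For n ≥ 1 and q > n, there exists a constant A > 0 such that for all x ∈ ℝⁿ, the principal value integral |lim_{ε→0} ∫_{|y|≥ε} (⟨x⟩^{-q} − ⟨x+y⟩^{-q}) / |y|^{n+1} dy| ≤ A ⟨x⟩^{-n-1}. -/
open Filter
lemma taylor_aux (p : ℝ) : ∃ δ > (0:ℝ), ∃ K > (0:ℝ), ∀ u : ℝ, |u| ≤ δ →
    0 < 1 + u ∧ |(1 + u) ^ (-p) - 1 + p * u| ≤ K * u ^ 2 := by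
  have hd : ∀ u : ℝ, |u| ≤ 1/2 → HasDerivAt (fun u : ℝ => (1 + u) ^ (-p) - 1 + p * u)
      (-p * (1 + u) ^ (-p - 1) + p) u := by
    intro u hu
    have h1 : (1 + u) ≠ 0 := by have := abs_le.1 hu; linarith
    have h2 : HasDerivAt (fun u : ℝ => 1 + u) 1 u := (hasDerivAt_id u).const_add 1
    have h3 := ((h2.rpow_const (p := -p) (Or.inl h1)).sub_const 1).add
      ((hasDerivAt_id u).const_mul p)
    exact h3.congr_deriv (by ring)
  have hd2 : HasDerivAt (fun u : ℝ => -p * (1 + u) ^ (-p - 1) + p) (-p * (-p-1)) 0 := by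
    have h2 : HasDerivAt (fun u : ℝ => 1 + u) 1 0 := (hasDerivAt_id (0:ℝ)).const_add 1
    have h3 := ((h2.rpow_const (p := -p-1) (Or.inl (by norm_num))).const_mul (-p)).add_const p
    exact h3.congr_deriv (by simp)
  have hO := hd2.differentiableAt.isBigO_sub
  obtain ⟨K, hK, hb⟩ := hO.exists_pos
  rw [Asymptotics.IsBigOWith] at hb
  obtain ⟨δ, hδ, hb⟩ := Metric.eventually_nhds_iff.1 hb
  refine ⟨min (δ/2) (1/2), by positivity, K, hK, fun u hu => ?_⟩
  have hu1 : |u| ≤ δ / 2 := hu.trans (min_le_left _ _)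
  have hu2 : |u| ≤ 1 / 2 := hu.trans (min_le_right _ _)
  refine ⟨by have := abs_le.1 hu2; linarith, ?_⟩
  have := (convex_closedBall (0:ℝ) |u|).norm_image_sub_le_of_norm_hasDerivWithin_le
    (f := fun u : ℝ => (1 + u) ^ (-p) - 1 + p * u)
    (f' := fun u => -p * (1 + u) ^ (-p - 1) + p) (C := K * |u|) (x := 0) (y := u)
    (fun v hv => (hd v (by
      rw [mem_closedBall_zero_iff, Real.norm_eq_abs] at hv; linarith)).hasDerivWithinAt)
    (fun v hv => by
      rw [mem_closedBall_zero_iff, Real.norm_eq_abs] at hv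
      have h := hb (y := v) (by rw [dist_zero_right, Real.norm_eq_abs]; linarith)
      simp only [add_zero, Real.one_rpow, sub_zero] at h
      have e : -p * (1 + v) ^ (-p - 1) + p = -p * (1 + v) ^ (-p - 1) + p - (-p * 1 + p) := by ring
      rw [e]
      refine h.trans ?_
      rw [Real.norm_eq_abs]
      gcongr) (by simp) (by simp)
  simp only [add_zero, Real.one_rpow, mul_zero, sub_zero, sub_self, Real.norm_eq_abs] at this
  refine this.trans (le_of_eq ?_)
  rw [mul_assoc, ← sq, sq_abs]

lemma second_diff (p : ℝ) : ∃ ρ > (0:ℝ), ∃ K > (0:ℝ), ∀ a b r : ℝ, 0 < a → 0 ≤ r → r ≤ ρ →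
    |b| ≤ 2 * r * a →
    |2 * a ^ (-p) - (a + b + r ^ 2 * a) ^ (-p) - (a - b + r ^ 2 * a) ^ (-p)|
      ≤ K * r ^ 2 * a ^ (-p) := by
  obtain ⟨δ, hδ, K, hK, H⟩ := taylor_aux p
  refine ⟨min 1 (δ / 3), by positivity, 2 * |p| + 18 * K, by positivity, ?_⟩
  intro a b r ha hr hr' hb
  have hr1 : r ≤ 1 := hr'.trans (min_le_left _ _)
  have hr2 : r ≤ δ / 3 := hr'.trans (min_le_right _ _)
  obtain ⟨s, rfl⟩ : ∃ s, b = s * a := ⟨b / a, by field_simp⟩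
  have hs : |s| ≤ 2 * r := by
    rw [abs_mul, abs_of_pos ha] at hb
    exact le_of_mul_le_mul_right hb ha
  obtain ⟨hs1, hs2⟩ := abs_le.1 hs
  have hu : |s + r ^ 2| ≤ 3 * r := abs_le.2 ⟨by nlinarith, by nlinarith⟩
  have hv : |-s + r ^ 2| ≤ 3 * r := abs_le.2 ⟨by nlinarith, by nlinarith⟩
  obtain ⟨p1, h1⟩ := H _ (hu.trans (by linarith))
  obtain ⟨p2, h2⟩ := H _ (hv.trans (by linarith))
  have q1 : (s + r ^ 2) ^ 2 ≤ 9 * r ^ 2 := by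
    have := sq_le_sq' (by linarith [abs_nonneg (s + r^2)]) hu; rw [sq_abs] at this; linarith
  have q2 : (-s + r ^ 2) ^ 2 ≤ 9 * r ^ 2 := by
    have := sq_le_sq' (by linarith [abs_nonneg (-s + r^2)]) hv; rw [sq_abs] at this; linarith
  have e1 : a + s * a + r ^ 2 * a = (1 + (s + r ^ 2)) * a := by ring
  have e2 : a - s * a + r ^ 2 * a = (1 + (-s + r ^ 2)) * a := by ring
  rw [e1, e2, Real.mul_rpow p1.le ha.le, Real.mul_rpow p2.le ha.le]
  have e3 : ∀ X Y Z : ℝ, 2 * Z - X * Z - Y * Z = (2 - X - Y) * Z := by intros; ring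
  rw [e3, abs_mul, abs_of_pos (Real.rpow_pos_of_pos ha _)]
  refine mul_le_mul_of_nonneg_right ?_ (Real.rpow_pos_of_pos ha _).le
  rw [abs_le] at h1 h2 ⊢
  have m1 := mul_le_mul_of_nonneg_left q1 hK.le
  have m2 := mul_le_mul_of_nonneg_left q2 hK.le
  have n1 := mul_le_mul_of_nonneg_right (le_abs_self p) (sq_nonneg r)
  have n2 := mul_le_mul_of_nonneg_right (neg_abs_le p) (sq_nonneg r)
  constructor <;> nlinarith

open MeasureTheory in
lemma radial_near (n : ℕ) (hn : 1 ≤ n) : ∃ V ≥ (0:ℝ), ∀ R > (0:ℝ),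
    (Integrable (fun y : EuclideanSpace ℝ (Fin n) =>
        (Set.Iic R).indicator (fun t : ℝ => t ^ 2 / t ^ (n + 1)) ‖y‖) ∧
      ∫ y : EuclideanSpace ℝ (Fin n),
        (Set.Iic R).indicator (fun t : ℝ => t ^ 2 / t ^ (n + 1)) ‖y‖ = V * R) ∧
    (Integrable (fun y : EuclideanSpace ℝ (Fin n) =>
        (Set.Ioi R).indicator (fun t : ℝ => 1 / t ^ (n + 1)) ‖y‖) ∧
      ∫ y : EuclideanSpace ℝ (Fin n),
        (Set.Ioi R).indicator (fun t : ℝ => 1 / t ^ (n + 1)) ‖y‖ = V * (1 / R)) := by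
  have : Nonempty (Fin n) := ⟨⟨0, hn⟩⟩
  have hnt : Nontrivial (EuclideanSpace ℝ (Fin n)) := inferInstance
  refine ⟨n * (volume : Measure (EuclideanSpace ℝ (Fin n))).real (Metric.ball 0 1),
    by positivity, fun R hR => ?_⟩
  obtain ⟨m, rfl⟩ : ∃ m, n = m + 1 := ⟨n - 1, by omega⟩
  have e1 : Set.EqOn (fun y : ℝ => y ^ m • (Set.Iic R).indicator
      (fun t : ℝ => t ^ 2 / t ^ (m + 1 + 1)) y) ((Set.Iic R).indicator (fun _ => (1:ℝ)))
      (Set.Ioi 0) := by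
    intro y hy
    have hy : (0:ℝ) < y := hy
    by_cases h : y ≤ R
    · simp only [Set.indicator, Set.mem_Iic, h, if_true, smul_eq_mul]
      field_simp
      ring
    · simp [Set.indicator, h]
  have e2 : Set.EqOn (fun y : ℝ => y ^ m • (Set.Ioi R).indicator
      (fun t : ℝ => 1 / t ^ (m + 1 + 1)) y) ((Set.Ioi R).indicator (fun t => t ^ (-2:ℝ)))
      (Set.Ioi 0) := by
    intro y hy
    have hy : (0:ℝ) < y := hy
    by_cases h : R < y
    · simp only [Set.indicator, Set.mem_Ioi, h, if_true, smul_eq_mul]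
      rw [Real.rpow_neg hy.le, Real.rpow_ofNat]
      field_simp
      ring
    · simp [Set.indicator, h]
  have i1 : Set.Ioi (0:ℝ) ∩ Set.Iic R = Set.Ioc 0 R := by ext; simp
  have i2 : Set.Ioi (0:ℝ) ∩ Set.Ioi R = Set.Ioi R := by
    rw [Set.Ioi_inter_Ioi, max_eq_right hR.le]
  refine ⟨⟨?_, ?_⟩, ⟨?_, ?_⟩⟩
  · rw [integrable_fun_norm_addHaar]
    simp only [finrank_euclideanSpace, Fintype.card_fin, Nat.add_sub_cancel]
    rw [integrableOn_congr_fun e1 measurableSet_Ioi, IntegrableOn,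
      integrable_indicator_iff measurableSet_Iic, IntegrableOn,
      Measure.restrict_restrict measurableSet_Iic, Set.inter_comm, i1]
    exact integrable_const _
  · rw [integral_fun_norm_addHaar]
    simp only [finrank_euclideanSpace, Fintype.card_fin, Nat.add_sub_cancel]
    rw [setIntegral_congr_fun measurableSet_Ioi e1, setIntegral_indicator measurableSet_Iic, i1]
    simp [hR.le, mul_assoc]
  · rw [integrable_fun_norm_addHaar]
    simp only [finrank_euclideanSpace, Fintype.card_fin, Nat.add_sub_cancel]
    rw [integrableOn_congr_fun e2 measurableSet_Ioi, IntegrableOn,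
      integrable_indicator_iff measurableSet_Ioi, IntegrableOn,
      Measure.restrict_restrict measurableSet_Ioi, Set.inter_comm, i2]
    exact integrableOn_Ioi_rpow_of_lt (by norm_num) hR
  · rw [integral_fun_norm_addHaar]
    simp only [finrank_euclideanSpace, Fintype.card_fin, Nat.add_sub_cancel]
    rw [setIntegral_congr_fun measurableSet_Ioi e2, setIntegral_indicator measurableSet_Ioi, i2,
      integral_Ioi_rpow_of_lt (by norm_num) hR]
    have : -R ^ ((-2:ℝ) + 1) / (-2 + 1) = 1 / R := by
      norm_num [Real.rpow_neg_one]
    rw [this]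
    simp [mul_assoc]

open MeasureTheory in
/-- the truncated bound -/
lemma trunc_bound (n : ℕ) (hn : 1 ≤ n) (q : ℝ) (hq : (n : ℝ) < q) :
    ∃ A > (0:ℝ), ∀ (x : EuclideanSpace ℝ (Fin n)) (ε : ℝ), 0 < ε →
      |∫ y in {y : EuclideanSpace ℝ (Fin n) | ε ≤ ‖y‖},
          ((1 + ‖x‖ ^ 2) ^ (-q / 2) - (1 + ‖x + y‖ ^ 2) ^ (-q / 2)) / ‖y‖ ^ (n + 1)|
        ≤ A * (1 + ‖x‖ ^ 2) ^ (-((n : ℝ) + 1) / 2) := by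
  obtain ⟨ρ, hρ, K, hK, H⟩ := second_diff (q / 2)
  obtain ⟨V, hV, HV⟩ := radial_near n hn
  have hfi : Integrable (fun z : EuclideanSpace ℝ (Fin n) => (1 + ‖z‖ ^ 2) ^ (-q / 2)) :=
    integrable_rpow_neg_one_add_norm_sq (by simpa using hq)
  set f : EuclideanSpace ℝ (Fin n) → ℝ := fun z => (1 + ‖z‖ ^ 2) ^ (-q / 2) with hf
  have hf0 : ∀ z, 0 ≤ f z := fun z => by simp only [hf]; positivity
  set S := ∫ z, f z with hS
  have hS0 : 0 ≤ S := integral_nonneg hf0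
  refine ⟨K * V * ρ + 2 * V / ρ + 2 * S / ρ ^ (n + 1) + 1, by positivity, fun x ε hε => ?_⟩
  set w := √(1 + ‖x‖ ^ 2) with hw
  have hw2 : w ^ 2 = 1 + ‖x‖ ^ 2 := Real.sq_sqrt (by positivity)
  have hwx : ‖x‖ ≤ w := Real.le_sqrt_of_sq_le (by linarith)
  have hw1 : 1 ≤ w := Real.le_sqrt_of_sq_le (by nlinarith [sq_nonneg ‖x‖])
  have hw0 : 0 < w := by linarith
  have hwp : ∀ s : ℝ, (1 + ‖x‖ ^ 2) ^ (-s / 2) = w ^ (-s) := by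
    intro s
    rw [← hw2, ← Real.rpow_natCast, ← Real.rpow_mul hw0.le]
    congr 1; push_cast; ring
  have hfx : f x = w ^ (-q) := hwp q
  rw [hwp ((n : ℝ) + 1)]
  set R := ρ * w with hR
  have hR0 : 0 < R := by positivity
  obtain ⟨⟨a1, a2⟩, ⟨b1, b2⟩⟩ := HV R hR0
  set E : Set (EuclideanSpace ℝ (Fin n)) := {y | ε ≤ ‖y‖} with hE
  have hEm : MeasurableSet E := measurableSet_le measurable_const measurable_norm
  change |∫ y in E, (f x - f (x + y)) / ‖y‖ ^ (n + 1)| ≤ _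
  by_cases hInt1 : IntegrableOn (fun y => (f x - f (x + y)) / ‖y‖ ^ (n + 1)) E
  swap
  · rw [integral_undef hInt1, abs_zero]; positivity
  -- reflection
  have hmp : MeasurePreserving (fun y : EuclideanSpace ℝ (Fin n) => -y) volume volume :=
    Measure.measurePreserving_neg volume
  have hpre : (fun y : EuclideanSpace ℝ (Fin n) => -y) ⁻¹' E = E := by
    ext y; simp [hE]
  have hemb : MeasurableEmbedding (fun y : EuclideanSpace ℝ (Fin n) => -y) :=
    (MeasurableEquiv.neg _).measurableEmbedding
  have hInt2 : IntegrableOn (fun y => (f x - f (x - y)) / ‖y‖ ^ (n + 1)) E := by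
    have := (hmp.integrableOn_comp_preimage hemb).2 hInt1
    rw [hpre] at this
    simpa [Function.comp_def, sub_eq_add_neg] using this
  have hrefl : ∫ y in E, (f x - f (x - y)) / ‖y‖ ^ (n + 1)
      = ∫ y in E, (f x - f (x + y)) / ‖y‖ ^ (n + 1) := by
    have := hmp.setIntegral_preimage_emb hemb
      (fun y => (f x - f (x + y)) / ‖y‖ ^ (n + 1)) E
    rw [hpre] at this
    simpa [sub_eq_add_neg] using this
  set I := ∫ y in E, (f x - f (x + y)) / ‖y‖ ^ (n + 1) with hI
  have hsum : 2 * I = ∫ y in E, (2 * f x - f (x + y) - f (x - y)) / ‖y‖ ^ (n + 1) := by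
    rw [two_mul]
    nth_rewrite 2 [← hrefl]
    rw [hI, ← integral_add hInt1 hInt2]
    congr 1; ext y; ring
  -- dominating function
  set G : EuclideanSpace ℝ (Fin n) → ℝ := fun y =>
    (K * (w ^ (-q) / w ^ 2)) * (Set.Iic R).indicator (fun t : ℝ => t ^ 2 / t ^ (n + 1)) ‖y‖
    + (2 * w ^ (-q)) * (Set.Ioi R).indicator (fun t : ℝ => 1 / t ^ (n + 1)) ‖y‖
    + (1 / R ^ (n + 1)) * (f (x + y) + f (x - y)) with hG
  have c1 : Integrable (fun y => f (x + y)) := hfi.comp_add_left x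
  have c2 : Integrable (fun y => f (x - y)) := hfi.comp_sub_left x
  have d1 := a1.const_mul (K * (w ^ (-q) / w ^ 2))
  have d2 := b1.const_mul (2 * w ^ (-q))
  have d3 := (c1.add c2).const_mul (1 / R ^ (n + 1))
  have hGi : Integrable G := (d1.add d2).add d3
  have hGv : ∫ y, G y = (K * (w ^ (-q) / w ^ 2)) * (V * R) + (2 * w ^ (-q)) * (V * (1 / R))
      + (1 / R ^ (n + 1)) * (S + S) := by
    have s1 : ∫ y, f (x + y) = S := integral_add_left_eq_self f x
    have s2 : ∫ y, f (x - y) = S := integral_sub_left_eq_self f volume x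
    have t1 := integral_add (d1.add d2) d3
    have t2 := integral_add d1 d2
    have t3 := integral_add c1 c2
    simp only [Pi.add_apply] at t1 t2 t3
    rw [hG, t1, t2, integral_const_mul, integral_const_mul, integral_const_mul, a2, b2, t3, s1, s2]
  have hG0 : ∀ y, 0 ≤ G y := by
    intro y
    have : 0 ≤ (Set.Iic R).indicator (fun t : ℝ => t ^ 2 / t ^ (n + 1)) ‖y‖ := by
      rw [Set.indicator_apply]; split_ifs <;> positivity
    have : 0 ≤ (Set.Ioi R).indicator (fun t : ℝ => 1 / t ^ (n + 1)) ‖y‖ := by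
      rw [Set.indicator_apply]; split_ifs <;> positivity
    have := hf0 (x + y)
    have := hf0 (x - y)
    simp only [hG]; positivity
  have hdom : ∀ y, ‖(2 * f x - f (x + y) - f (x - y)) / ‖y‖ ^ (n + 1)‖ ≤ G y := by
    intro y
    have g1 := hf0 (x + y)
    have g2 := hf0 (x - y)
    have g3 := hf0 x
    rw [Real.norm_eq_abs, abs_div, abs_of_nonneg (by positivity : 0 ≤ ‖y‖ ^ (n + 1))]
    by_cases hy : ‖y‖ ≤ R
    · have hb : |2 * inner ℝ x y| ≤ 2 * (‖y‖ / w) * w ^ 2 := by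
        rw [abs_mul, abs_two]
        have := abs_real_inner_le_norm x y
        have e : 2 * (‖y‖ / w) * w ^ 2 = 2 * (w * ‖y‖) := by field_simp
        rw [e]
        have := mul_le_mul_of_nonneg_right hwx (norm_nonneg y)
        linarith
      have h := H (w ^ 2) (2 * inner ℝ x y) (‖y‖ / w) (by positivity) (by positivity)
        (by rw [div_le_iff₀ hw0]; exact hy) hb
      have e0 : (‖y‖ / w) ^ 2 * w ^ 2 = ‖y‖ ^ 2 := by field_simp
      have e1 : w ^ 2 + 2 * inner ℝ x y + ‖y‖ ^ 2 = 1 + ‖x + y‖ ^ 2 := by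
        rw [norm_add_sq_real, hw2]; ring
      have e2 : w ^ 2 - 2 * inner ℝ x y + ‖y‖ ^ 2 = 1 + ‖x - y‖ ^ 2 := by
        rw [norm_sub_sq_real, hw2]; ring
      rw [e0, e1, e2, hw2, ← neg_div] at h
      change |2 * f x - f (x + y) - f (x - y)| ≤ K * (‖y‖ / w) ^ 2 * f x at h
      have hlast : 0 ≤ (1 / R ^ (n + 1)) * (f (x + y) + f (x - y)) := by positivity
      have : G y = K * (‖y‖ / w) ^ 2 * f x / ‖y‖ ^ (n + 1)
          + (1 / R ^ (n + 1)) * (f (x + y) + f (x - y)) := by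
        simp only [hG, Set.indicator_apply, Set.mem_Iic, Set.mem_Ioi, hy, not_lt.2 hy, if_true,
          if_false, hfx]
        ring
      rw [this]
      have := div_le_div_of_nonneg_right h (by positivity : 0 ≤ ‖y‖ ^ (n + 1))
      linarith
    · have hy' : R < ‖y‖ := not_le.1 hy
      have hpow : 1 / ‖y‖ ^ (n + 1) ≤ 1 / R ^ (n + 1) :=
        one_div_le_one_div_of_le (by positivity) (by gcongr)
      have : G y = 2 * f x * (1 / ‖y‖ ^ (n + 1))
          + (1 / R ^ (n + 1)) * (f (x + y) + f (x - y)) := by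
        simp only [hG, Set.indicator_apply, Set.mem_Iic, Set.mem_Ioi, hy, hy', if_true,
          if_false, hfx]
        ring
      rw [this, div_eq_mul_one_div]
      have habs : |2 * f x - f (x + y) - f (x - y)| ≤ 2 * f x + (f (x + y) + f (x - y)) := by
        rw [abs_le]; constructor <;> linarith
      have m1 := mul_le_mul_of_nonneg_right habs (by positivity : 0 ≤ 1 / ‖y‖ ^ (n + 1))
      have m2 := mul_le_mul_of_nonneg_right hpow (add_nonneg g1 g2)
      linarith
  have hmain : |2 * I| ≤ ∫ y, G y := by
    rw [hsum, ← Real.norm_eq_abs]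
    refine (norm_integral_le_of_norm_le hGi.integrableOn (Eventually.of_forall hdom)).trans ?_
    exact setIntegral_le_integral hGi (Eventually.of_forall hG0)
  rw [hGv, abs_mul, abs_two] at hmain
  have hWle : w ^ (-q) / w ≤ w ^ (-((n:ℝ) + 1)) := by
    rw [div_eq_mul_inv, ← Real.rpow_neg_one w, ← Real.rpow_add hw0]
    exact Real.rpow_le_rpow_of_exponent_le hw1 (by linarith)
  have hWn : 1 / w ^ (n + 1) = w ^ (-((n:ℝ) + 1)) := by
    rw [Real.rpow_neg hw0.le, one_div]
    congr 1
    rw [← Real.rpow_natCast]; push_cast; rfl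
  set W := w ^ (-((n:ℝ) + 1)) with hWdef
  have hW0 : 0 < W := Real.rpow_pos_of_pos hw0 _
  have f1 : (K * (w ^ (-q) / w ^ 2)) * (V * R) = (K * V * ρ) * (w ^ (-q) / w) := by
    rw [hR]; field_simp
  have f2 : (2 * w ^ (-q)) * (V * (1 / R)) = (2 * V / ρ) * (w ^ (-q) / w) := by
    rw [hR]; field_simp
  have f3 : (1 / R ^ (n + 1)) * (S + S) = (2 * S / ρ ^ (n + 1)) * W := by
    rw [hR, ← hWn, mul_pow]; field_simp; ring
  rw [f1, f2, f3] at hmain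
  have k1 := mul_le_mul_of_nonneg_left hWle (by positivity : 0 ≤ K * V * ρ)
  have k2 := mul_le_mul_of_nonneg_left hWle (by positivity : 0 ≤ 2 * V / ρ)
  have k0 := abs_nonneg I
  nlinarith

/-- Pointwise bound for the half-Laplacian of the weight `⟨·⟩^{-q}`, case `q > n`:
any principal-value limit `L` of the singular integral satisfies `|L| ≤ A ⟨x⟩^{-n-1}`. -/
theorem halfLaplacian_weight_bound_supercritical (n : ℕ) (hn : 1 ≤ n) (q : ℝ)
    (hq : (n : ℝ) < q) :
    ∃ A > (0:ℝ), ∀ (x : EuclideanSpace ℝ (Fin n)) (L : ℝ),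
      Tendsto
        (fun ε : ℝ => ∫ y in {y : EuclideanSpace ℝ (Fin n) | ε ≤ ‖y‖},
          ((1 + ‖x‖ ^ 2) ^ (-q / 2) - (1 + ‖x + y‖ ^ 2) ^ (-q / 2)) / ‖y‖ ^ (n + 1))
        (nhdsWithin 0 (Set.Ioi 0)) (nhds L) →
      |L| ≤ A * (1 + ‖x‖ ^ 2) ^ (-((n : ℝ) + 1) / 2) := by
  obtain ⟨A, hA, H⟩ := trunc_bound n hn q hq
  refine ⟨A, hA, fun x L hL => le_of_tendsto hL.abs ?_⟩
  filter_upwards [self_mem_nhdsWithin] with ε hε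
  exact H x ε hε
end

section
/- For n ≥ 1 and q = n, there exists a constant A > 0 such that for all x ∈ ℝⁿ, |lim_{ε→0} ∫_{|y|≥ε} (⟨x⟩^{-n} − ⟨x+y⟩^{-n}) / |y|^{n+1} dy| ≤ A ⟨x⟩^{-n-1} (1 + log(1+|x|)). -/
open Filter MeasureTheory
lemma hl_bern (q u : ℝ) (hq : 0 < q) (hu : 0 < u) : 1 - q * (u - 1) ≤ u ^ (-q) := by
  have h1 := Real.add_one_le_exp (-q * Real.log u)
  have h2 := Real.log_le_sub_one_of_pos hu
  rw [Real.rpow_def_of_pos hu]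
  have : Real.log u * -q = -q * Real.log u := by ring
  rw [this]
  nlinarith

lemma hl_bern2 (q u : ℝ) (hq : 0 < q) (hu : 0 < u) :
    u ^ (-q) ≤ 1 - q * u ^ (-q - 1) * (u - 1) := by
  have h := hl_bern q u⁻¹ hq (by positivity)
  have h1 : (u⁻¹) ^ (-q) * u ^ (-q) = 1 := by
    rw [← Real.mul_rpow (by positivity) hu.le, inv_mul_cancel₀ hu.ne', Real.one_rpow]
  have h2 : u ^ (-q - 1) = u ^ (-q) * u⁻¹ := by
    rw [Real.rpow_sub_one hu.ne']; rfl
  have h3 : 0 < u ^ (-q) := by positivity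
  have h4 := mul_le_mul_of_nonneg_right h h3.le
  rw [h1] at h4
  rw [h2]
  have : u ^ (-q) * u⁻¹ * (u - 1) = u ^ (-q) * (1 - u⁻¹) := by field_simp
  nlinarith

lemma hl_lip (q u : ℝ) (hq : 0 < q) (hu : 1/4 ≤ u) :
    |1 - u ^ (-q)| ≤ q * 4 ^ (q + 1) * |u - 1| := by
  have hu0 : 0 < u := by linarith
  have h1 := hl_bern q u hq hu0
  have h2 := hl_bern2 q u hq hu0
  have h3 : u ^ (-q - 1) ≤ 4 ^ (q + 1) := by
    have : u ^ (-q - 1) ≤ (1/4 : ℝ) ^ (-q - 1) :=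
      Real.rpow_le_rpow_of_nonpos (by norm_num) hu (by linarith)
    refine this.trans (le_of_eq ?_)
    rw [one_div, Real.inv_rpow (by norm_num), ← Real.rpow_neg (by norm_num)]
    congr 1; ring
  have h4 : (1:ℝ) ≤ 4 ^ (q + 1) := Real.one_le_rpow (by norm_num) (by linarith)
  have h5 : 0 < u ^ (-q - 1) := by positivity
  have h6 := neg_abs_le (u - 1)
  have h7 := le_abs_self (u - 1)
  have h8 := abs_nonneg (u - 1)
  rw [abs_le]
  constructor
  · have : u ^ (-q - 1) * (-(u - 1)) ≤ 4 ^ (q + 1) * |u - 1| :=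
      (mul_le_mul_of_nonneg_left (by linarith) h5.le).trans (mul_le_mul_of_nonneg_right h3 h8)
    nlinarith
  · have : (u - 1) ≤ 4 ^ (q + 1) * |u - 1| := by nlinarith
    nlinarith

lemma hl_taylor (p u : ℝ) (hp : 0 < p) (hu : 1/4 ≤ u) :
    |u ^ (-p) - 1 + p * (u - 1)| ≤ p * (p + 1) * 4 ^ (p + 2) * (u - 1) ^ 2 := by
  have hu0 : 0 < u := by linarith
  have h1 := hl_bern p u hp hu0
  have h2 := hl_bern2 p u hp hu0
  have h3 := hl_lip (p + 1) u (by linarith) hu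
  have e1 : -(p + 1) = -p - 1 := by ring
  have e2 : p + 1 + 1 = p + 2 := by ring
  rw [e1, e2] at h3
  rw [abs_of_nonneg (by linarith)]
  have h4 : (u - 1) * (1 - u ^ (-p - 1)) ≤ |u - 1| * ((p + 1) * 4 ^ (p + 2) * |u - 1|) := by
    refine (le_abs_self _).trans ?_
    rw [abs_mul]
    gcongr
  have h5 : |u - 1| * |u - 1| = (u - 1) ^ 2 := by rw [← sq, sq_abs]
  calc _ ≤ p * ((u - 1) * (1 - u ^ (-p - 1))) := by nlinarith
    _ ≤ p * (|u - 1| * ((p + 1) * 4 ^ (p + 2) * |u - 1|)) := by gcongr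
    _ = p * (p + 1) * 4 ^ (p + 2) * (|u - 1| * |u - 1|) := by ring
    _ = _ := by rw [h5]

lemma hl_second (p : ℝ) (hp : 0 < p) : ∃ K > (0:ℝ), ∀ a b t : ℝ, 0 < a → 0 ≤ b → b ≤ a / 4 →
    t ^ 2 ≤ 4 * a * b → a / 4 ≤ a + b + t → a / 4 ≤ a + b - t →
    |2 * a ^ (-p) - (a + b + t) ^ (-p) - (a + b - t) ^ (-p)| ≤ K * a ^ (-p - 1) * b := by
  refine ⟨2 * p + 10 * (p * (p + 1) * 4 ^ (p + 2)), by positivity, ?_⟩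
  intro a b t ha hb hba ht h1 h2
  have q1 := hl_taylor p ((a + b + t) / a) hp (by rw [le_div_iff₀ ha]; linarith)
  have q2 := hl_taylor p ((a + b - t) / a) hp (by rw [le_div_iff₀ ha]; linarith)
  have r1 : (a + b + t) ^ (-p) = a ^ (-p) * ((a + b + t) / a) ^ (-p) := by
    rw [← Real.mul_rpow ha.le (div_nonneg (by linarith) ha.le)]; congr 1; field_simp
  have r2 : (a + b - t) ^ (-p) = a ^ (-p) * ((a + b - t) / a) ^ (-p) := by
    rw [← Real.mul_rpow ha.le (div_nonneg (by linarith) ha.le)]; congr 1; field_simp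
  rw [r1, r2, Real.rpow_sub_one ha.ne']
  set U := ((a + b + t) / a) ^ (-p)
  set V := ((a + b - t) / a) ^ (-p)
  set M := p * (p + 1) * (4:ℝ) ^ (p + 2)
  have hM : 0 < M := by positivity
  have s1 : (a + b + t) / a - 1 = (b + t) / a := by field_simp; ring
  have s2 : (a + b - t) / a - 1 = (b - t) / a := by field_simp; ring
  rw [s1] at q1
  rw [s2] at q2
  have e3 : ((b + t) / a) ^ 2 + ((b - t) / a) ^ 2 ≤ 10 * (b / a) := by
    have : ((b + t) / a) ^ 2 + ((b - t) / a) ^ 2 = (2 * b ^ 2 + 2 * t ^ 2) / a ^ 2 := by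
      field_simp; ring
    rw [this, div_le_iff₀ (by positivity)]
    have : 10 * (b / a) * a ^ 2 = 10 * b * a := by field_simp
    rw [this]; nlinarith
  have e4 : p * ((b + t) / a) + p * ((b - t) / a) = 2 * p * (b / a) := by field_simp; ring
  have e5 : |2 - U - V| ≤ (2 * p + 10 * M) * (b / a) := by
    have hb' : 0 ≤ b / a := by positivity
    have hpb : 0 ≤ p * (b / a) := by positivity
    rw [abs_le] at *
    have := mul_le_mul_of_nonneg_left e3 hM.le
    constructor <;> nlinarith
  have : 2 * a ^ (-p) - a ^ (-p) * U - a ^ (-p) * V = a ^ (-p) * (2 - U - V) := by ring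
  rw [this, abs_mul, abs_of_pos (by positivity)]
  calc _ ≤ a ^ (-p) * ((2 * p + 10 * M) * (b / a)) := by gcongr
    _ = _ := by ring

lemma hl_radial (n : ℕ) (hn : 1 ≤ n) (S : Set ℝ) (hS : MeasurableSet S) (f g : ℝ → ℝ)
    (hfm : Measurable f) (hf : ∀ r ∈ S, 0 < r → 0 ≤ f r ∧ r ^ (n - 1) * f r ≤ g r)
    (hg : IntegrableOn g (S ∩ Set.Ioi 0)) :
    IntegrableOn (fun y : EuclideanSpace ℝ (Fin n) => f ‖y‖) {y | ‖y‖ ∈ S} ∧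
    ∫ y in {y : EuclideanSpace ℝ (Fin n) | ‖y‖ ∈ S}, f ‖y‖ ≤
      n * volume.real (Metric.ball (0 : EuclideanSpace ℝ (Fin n)) 1) *
        ∫ r in S ∩ Set.Ioi 0, g r := by
  have : Nonempty (Fin n) := ⟨⟨0, hn⟩⟩
  have hSm : MeasurableSet {y : EuclideanSpace ℝ (Fin n) | ‖y‖ ∈ S} := measurable_norm hS
  have hind : (fun y : EuclideanSpace ℝ (Fin n) => S.indicator f ‖y‖) =
      Set.indicator {y | ‖y‖ ∈ S} (fun y => f ‖y‖) := by
    ext y; simp only [Set.indicator]; rfl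
  have hind2 : (fun r : ℝ => r ^ (n - 1) * S.indicator f r) =
      S.indicator (fun r => r ^ (n - 1) * f r) := by
    ext y; by_cases h : y ∈ S <;> simp [h]
  have hint : IntegrableOn (fun r => r ^ (n - 1) * f r) (S ∩ Set.Ioi 0) := by
    refine Integrable.mono' hg (by fun_prop) ?_
    filter_upwards [ae_restrict_mem (hS.inter measurableSet_Ioi)] with r hr
    have := hf r hr.1 hr.2
    have hr0 : 0 < r := hr.2
    rw [Real.norm_of_nonneg (mul_nonneg (by positivity) this.1)]
    exact this.2
  constructor
  · have h := (integrable_fun_norm_addHaar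
      (volume : Measure (EuclideanSpace ℝ (Fin n))) (f := S.indicator f))
    rw [hind, integrable_indicator_iff hSm] at h
    rw [h]
    simp only [finrank_euclideanSpace, Fintype.card_fin, smul_eq_mul]
    rw [hind2, IntegrableOn, integrable_indicator_iff hS, IntegrableOn, Measure.restrict_restrict hS]
    exact hint
  · have h := (integral_fun_norm_addHaar
      (volume : Measure (EuclideanSpace ℝ (Fin n))) (S.indicator f))
    rw [hind, integral_indicator hSm] at h
    rw [h]
    simp only [finrank_euclideanSpace, Fintype.card_fin, smul_eq_mul, nsmul_eq_mul]
    rw [hind2, integral_indicator hS, Measure.restrict_restrict hS, ← mul_assoc]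
    refine mul_le_mul_of_nonneg_left ?_ (by positivity)
    refine setIntegral_mono_on hint hg (hS.inter measurableSet_Ioi) fun r hr => (hf r hr.1 hr.2).2

lemma hl_inner (n : ℕ) (hn : 1 ≤ n) (R : ℝ) (hR : 0 < R) :
    IntegrableOn (fun y : EuclideanSpace ℝ (Fin n) => ‖y‖ ^ 2 / ‖y‖ ^ (n + 1)) {y | ‖y‖ < R} ∧
    ∫ y in {y : EuclideanSpace ℝ (Fin n) | ‖y‖ < R}, ‖y‖ ^ 2 / ‖y‖ ^ (n + 1) ≤
      n * volume.real (Metric.ball (0 : EuclideanSpace ℝ (Fin n)) 1) * R := by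
  have h := hl_radial n hn (Set.Iio R) measurableSet_Iio (fun r => r ^ 2 / r ^ (n + 1))
    (fun _ => 1) (by fun_prop) ?_ ?_
  · refine ⟨h.1, h.2.trans (le_of_eq ?_)⟩
    have : Set.Iio R ∩ Set.Ioi 0 = Set.Ioo 0 R := by ext; simp [and_comm]
    rw [this]; simp [hR.le]
  · intro r _ hr
    refine ⟨by positivity, le_of_eq ?_⟩
    obtain ⟨m, rfl⟩ := Nat.exists_eq_add_of_le' hn
    simp only [Nat.add_sub_cancel]
    field_simp
    ring
  · have : Set.Iio R ∩ Set.Ioi 0 = Set.Ioo 0 R := by ext; simp [and_comm]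
    rw [this]
    exact integrableOn_const (by simp)

lemma hl_outer (n : ℕ) (hn : 1 ≤ n) (R : ℝ) (hR : 0 < R) :
    IntegrableOn (fun y : EuclideanSpace ℝ (Fin n) => 1 / ‖y‖ ^ (n + 1)) {y | R ≤ ‖y‖} ∧
    ∫ y in {y : EuclideanSpace ℝ (Fin n) | R ≤ ‖y‖}, 1 / ‖y‖ ^ (n + 1) ≤
      n * volume.real (Metric.ball (0 : EuclideanSpace ℝ (Fin n)) 1) * R⁻¹ := by
  have hs : Set.Ici R ∩ Set.Ioi 0 = Set.Ici R := by
    ext r; simp only [Set.mem_inter_iff, Set.mem_Ici, Set.mem_Ioi]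
    exact ⟨fun h => h.1, fun h => ⟨h, by linarith⟩⟩
  have h := hl_radial n hn (Set.Ici R) measurableSet_Ici (fun r => 1 / r ^ (n + 1))
    (fun r => r ^ (-2 : ℝ)) (by fun_prop) ?_ ?_
  · refine ⟨h.1, h.2.trans (le_of_eq ?_)⟩
    rw [hs, integral_Ici_eq_integral_Ioi, integral_Ioi_rpow_of_lt (by norm_num) hR]
    congr 1
    norm_num [Real.rpow_neg_one]
  · intro r _ hr
    refine ⟨by positivity, le_of_eq ?_⟩
    obtain ⟨m, rfl⟩ := Nat.exists_eq_add_of_le' hn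
    simp only [Nat.add_sub_cancel]
    rw [Real.rpow_neg hr.le]
    norm_num
    field_simp
    ring
  · rw [hs, integrableOn_Ici_iff_integrableOn_Ioi]
    exact integrableOn_Ioi_rpow_of_lt (by norm_num) hR

lemma hl_mid (n : ℕ) (hn : 1 ≤ n) (J : ℝ) (hJ : 0 < J) :
    IntegrableOn (fun y : EuclideanSpace ℝ (Fin n) => (1 + ‖y‖ ^ 2) ^ (-(n : ℝ) / 2))
      {y | ‖y‖ ≤ J} ∧
    ∫ y in {y : EuclideanSpace ℝ (Fin n) | ‖y‖ ≤ J}, (1 + ‖y‖ ^ 2) ^ (-(n : ℝ) / 2) ≤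
      n * volume.real (Metric.ball (0 : EuclideanSpace ℝ (Fin n)) 1) *
        (2 * Real.log (1 + J)) := by
  have hs : Set.Iic J ∩ Set.Ioi 0 = Set.Ioc 0 J := by ext; simp [and_comm]
  have hd : ∀ r ∈ Set.uIcc 0 J, HasDerivAt (fun r => 2 * Real.log (1 + r)) (2 / (1 + r)) r := by
    intro r hr
    rw [Set.uIcc_of_le hJ.le] at hr
    have h1 : HasDerivAt (fun r : ℝ => 1 + r) 1 r := (hasDerivAt_id r).const_add 1
    have := (h1.log (by linarith [hr.1])).const_mul 2
    exact this.congr_deriv (by ring)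
  have hi : IntervalIntegrable (fun r : ℝ => 2 / (1 + r)) volume 0 J := by
    apply ContinuousOn.intervalIntegrable
    rw [Set.uIcc_of_le hJ.le]
    refine ContinuousOn.div (by fun_prop) (by fun_prop) fun r hr => by linarith [hr.1]
  have h := hl_radial n hn (Set.Iic J) measurableSet_Iic (fun r => (1 + r ^ 2) ^ (-(n : ℝ) / 2))
    (fun r => 2 / (1 + r)) (by fun_prop) ?_ ?_
  · refine ⟨h.1, h.2.trans (le_of_eq ?_)⟩
    rw [hs, ← intervalIntegral.integral_of_le hJ.le,
      intervalIntegral.integral_eq_sub_of_hasDerivAt hd hi]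
    simp
  · intro r _ hr
    refine ⟨by positivity, ?_⟩
    obtain ⟨m, rfl⟩ := Nat.exists_eq_add_of_le' hn
    simp only [Nat.add_sub_cancel]
    have hpos : 0 < 1 + r ^ 2 := by positivity
    have e1 : (1 + r ^ 2) ^ (-((m + 1 : ℕ) : ℝ) / 2) = (√(1 + r ^ 2) ^ (m + 1))⁻¹ := by
      rw [neg_div, Real.rpow_neg hpos.le, Real.sqrt_eq_rpow, ← Real.rpow_mul_natCast hpos.le]
      congr 2; ring
    rw [e1]
    have hsq : r ≤ √(1 + r ^ 2) := Real.le_sqrt_of_sq_le (by linarith)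
    have hsq2 : (1 + r) / 2 ≤ √(1 + r ^ 2) := Real.le_sqrt_of_sq_le (by nlinarith)
    have hsp : 0 < √(1 + r ^ 2) := Real.sqrt_pos.2 hpos
    rw [← div_eq_mul_inv, div_le_div_iff₀ (by positivity) (by positivity), pow_succ]
    have : r ^ m ≤ √(1 + r ^ 2) ^ m := by gcongr
    calc r ^ m * (1 + r) ≤ √(1 + r ^ 2) ^ m * (2 * √(1 + r ^ 2)) := by
          gcongr; linarith
      _ = _ := by ring
  · rw [hs]
    exact (intervalIntegrable_iff_integrableOn_Ioc_of_le hJ.le).1 hi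

lemma hl_w_le (n : ℕ) (s : ℝ) (hs : 0 ≤ s) : (1 + s) ^ (-(n : ℝ) / 2) ≤ 1 := by
  apply Real.rpow_le_one_of_one_le_of_nonpos (by linarith)
  have : (0 : ℝ) ≤ n := by positivity
  linarith

lemma hl_integrable (n : ℕ) (hn : 1 ≤ n) (x : EuclideanSpace ℝ (Fin n)) (ε : ℝ) (hε : 0 < ε) :
    IntegrableOn (fun y : EuclideanSpace ℝ (Fin n) =>
      ((1 + ‖x‖ ^ 2) ^ (-(n : ℝ) / 2) - (1 + ‖x + y‖ ^ 2) ^ (-(n : ℝ) / 2)) / ‖y‖ ^ (n + 1))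
      {y | ε ≤ ‖y‖} := by
  refine Integrable.mono' (hl_outer n hn ε hε).1 (Measurable.aestronglyMeasurable (by fun_prop)) ?_
  refine Eventually.of_forall fun y => ?_
  rw [norm_div, Real.norm_eq_abs, norm_pow, norm_norm]
  gcongr
  have h1 := hl_w_le n (‖x‖ ^ 2) (by positivity)
  have h2 := hl_w_le n (‖x + y‖ ^ 2) (by positivity)
  have h3 : 0 ≤ (1 + ‖x‖ ^ 2) ^ (-(n : ℝ) / 2) := by positivity
  have h4 : 0 ≤ (1 + ‖x + y‖ ^ 2) ^ (-(n : ℝ) / 2) := by positivity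
  rw [abs_le]; constructor <;> linarith

lemma hl_near (n : ℕ) (hn : 1 ≤ n) : ∃ K > (0:ℝ), ∀ (x : EuclideanSpace ℝ (Fin n)) (ε : ℝ),
    0 < ε →
    |∫ y in {y : EuclideanSpace ℝ (Fin n) | ε ≤ ‖y‖} ∩ {y | ‖y‖ < √(1 + ‖x‖ ^ 2) / 2},
      ((1 + ‖x‖ ^ 2) ^ (-(n : ℝ) / 2) - (1 + ‖x + y‖ ^ 2) ^ (-(n : ℝ) / 2)) / ‖y‖ ^ (n + 1)| ≤
    K * (1 + ‖x‖ ^ 2) ^ (-((n : ℝ) + 1) / 2) := by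
  have hn0 : (0 : ℝ) < n := by exact_mod_cast hn
  obtain ⟨K, hK, hKb⟩ := hl_second ((n : ℝ) / 2) (by positivity)
  set c := volume.real (Metric.ball (0 : EuclideanSpace ℝ (Fin n)) 1) with hc
  have hc0 : 0 < c := by
    rw [hc, measureReal_def]
    exact ENNReal.toReal_pos (Metric.measure_ball_pos _ _ one_pos).ne' measure_ball_lt_top.ne
  refine ⟨K * (n * c), by positivity, ?_⟩
  intro x ε hε
  set a := 1 + ‖x‖ ^ 2 with ha
  have ha0 : 0 < a := by positivity
  have hJ : 0 < √a := Real.sqrt_pos.2 ha0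
  have hJ2 : √a ^ 2 = a := Real.sq_sqrt ha0.le
  set S := {y : EuclideanSpace ℝ (Fin n) | ε ≤ ‖y‖} ∩ {y | ‖y‖ < √a / 2} with hS
  have hSm : MeasurableSet S :=
    (measurableSet_le measurable_const measurable_norm).inter
      (measurableSet_lt measurable_norm measurable_const)
  set F : EuclideanSpace ℝ (Fin n) → ℝ := fun y =>
    (a ^ (-(n : ℝ) / 2) - (1 + ‖x + y‖ ^ 2) ^ (-(n : ℝ) / 2)) / ‖y‖ ^ (n + 1) with hF
  have hFi : IntegrableOn F S := (hl_integrable n hn x ε hε).mono_set Set.inter_subset_left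
  have hsymI : Integrable (fun y => S.indicator F (-y)) :=
    ((integrable_indicator_iff hSm).2 hFi).comp_neg
  have hind : (fun y => S.indicator F (-y)) = S.indicator (fun y => F (-y)) := by
    ext y
    have : -y ∈ S ↔ y ∈ S := by
      change (ε ≤ ‖-y‖ ∧ ‖-y‖ < √a / 2) ↔ (ε ≤ ‖y‖ ∧ ‖y‖ < √a / 2)
      rw [norm_neg]
    by_cases h : y ∈ S
    · rw [Set.indicator_of_mem h, Set.indicator_of_mem (this.2 h)]
    · rw [Set.indicator_of_notMem h, Set.indicator_of_notMem (fun h' => h (this.1 h'))]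
  have hFi' : IntegrableOn (fun y => F (-y)) S := by
    rw [← integrable_indicator_iff hSm, ← hind]; exact hsymI
  have hsym : ∫ y in S, F (-y) = ∫ y in S, F y := by
    rw [← integral_indicator hSm, ← hind, integral_neg_eq_self (S.indicator F) volume,
      integral_indicator hSm]
  have hdouble : 2 * ∫ y in S, F y = ∫ y in S, (F y + F (-y)) := by
    rw [integral_add hFi hFi', hsym]; ring
  obtain ⟨hi1, hi2⟩ := hl_inner n hn (√a / 2) (by positivity)
  have hbound : ‖∫ y in S, (F y + F (-y))‖ ≤
      ∫ y in S, (K * a ^ (-((n : ℝ) / 2) - 1)) * (‖y‖ ^ 2 / ‖y‖ ^ (n + 1)) := by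
    apply norm_integral_le_of_norm_le
    · exact (hi1.mono_set Set.inter_subset_right).const_mul _
    · filter_upwards [ae_restrict_mem hSm] with y hy
      have hy2 : ‖y‖ < √a / 2 := hy.2
      have e1 : ‖x + y‖ ^ 2 = ‖x‖ ^ 2 + 2 * inner ℝ x y + ‖y‖ ^ 2 := norm_add_sq_real x y
      have e2 : ‖x + -y‖ ^ 2 = ‖x‖ ^ 2 - 2 * inner ℝ x y + ‖y‖ ^ 2 := by
        rw [← sub_eq_add_neg]; exact norm_sub_sq_real x y
      have hin : |inner ℝ x y| ≤ ‖x‖ * ‖y‖ := abs_real_inner_le_norm x y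
      have hin2 := abs_le.1 hin
      have hy3 : ‖y‖ ^ 2 ≤ a / 4 := by
        have : ‖y‖ ^ 2 ≤ (√a / 2) ^ 2 := by gcongr
        rw [div_pow, hJ2] at this; linarith
      have hk := hKb a (‖y‖ ^ 2) (2 * inner ℝ x y) ha0 (by positivity) hy3 ?_ ?_ ?_
      · have f1 : a + ‖y‖ ^ 2 + 2 * inner ℝ x y = 1 + ‖x + y‖ ^ 2 := by rw [e1]; ring
        have f2 : a + ‖y‖ ^ 2 - 2 * inner ℝ x y = 1 + ‖x + -y‖ ^ 2 := by rw [e2]; ring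
        rw [f1, f2] at hk
        have f3 : F y + F (-y) = (2 * a ^ (-((n : ℝ) / 2)) - (1 + ‖x + y‖ ^ 2) ^ (-((n : ℝ) / 2))
            - (1 + ‖x + -y‖ ^ 2) ^ (-((n : ℝ) / 2))) / ‖y‖ ^ (n + 1) := by
          simp only [hF, norm_neg, neg_div]
          ring
        rw [f3, norm_div, Real.norm_eq_abs, norm_pow, norm_norm, ← mul_div_assoc]
        gcongr
      · have : (inner ℝ x y) ^ 2 ≤ (‖x‖ * ‖y‖) ^ 2 := by
          rw [← sq_abs]; gcongr
        have h2 : 0 ≤ ‖y‖ ^ 2 := by positivity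
        nlinarith
      · nlinarith [sq_nonneg (‖x‖ - 2 * ‖y‖)]
      · nlinarith [sq_nonneg (‖x‖ - 2 * ‖y‖)]
  have hmono : ∫ y in S, (‖y‖ ^ 2 / ‖y‖ ^ (n + 1)) ≤ n * c * (√a / 2) :=
    (setIntegral_mono_set hi1 (Eventually.of_forall fun y => by positivity)
      (Set.inter_subset_right.eventuallyLE)).trans hi2
  rw [integral_const_mul, ← hdouble, norm_mul, Real.norm_eq_abs, Real.norm_eq_abs, abs_two] at hbound
  have hpow : a ^ (-((n : ℝ) / 2) - 1) * √a = a ^ (-((n : ℝ) + 1) / 2) := by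
    rw [Real.sqrt_eq_rpow, ← Real.rpow_add ha0]; congr 1; ring
  have h3 : K * a ^ (-((n : ℝ) / 2) - 1) * ∫ y in S, (‖y‖ ^ 2 / ‖y‖ ^ (n + 1)) ≤
      K * a ^ (-((n : ℝ) / 2) - 1) * (n * c * (√a / 2)) := by gcongr
  have h4 : K * a ^ (-((n : ℝ) / 2) - 1) * (n * c * (√a / 2)) =
      K * (n * c) * a ^ (-((n : ℝ) + 1) / 2) / 2 := by rw [← hpow]; ring
  have h5 : 0 ≤ K * (n * c) * a ^ (-((n : ℝ) + 1) / 2) := by positivity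
  linarith

lemma hl_far (n : ℕ) (hn : 1 ≤ n) : ∃ K > (0:ℝ), ∀ (x : EuclideanSpace ℝ (Fin n)),
    |∫ y in {y : EuclideanSpace ℝ (Fin n) | √(1 + ‖x‖ ^ 2) / 2 ≤ ‖y‖},
      ((1 + ‖x‖ ^ 2) ^ (-(n : ℝ) / 2) - (1 + ‖x + y‖ ^ 2) ^ (-(n : ℝ) / 2)) / ‖y‖ ^ (n + 1)| ≤
    K * (1 + ‖x‖ ^ 2) ^ (-((n : ℝ) + 1) / 2) * (1 + Real.log (1 + ‖x‖)) := by
  have hn0 : (0 : ℝ) < n := by exact_mod_cast hn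
  set c := volume.real (Metric.ball (0 : EuclideanSpace ℝ (Fin n)) 1) with hc
  have hc0 : 0 < c := by
    rw [hc, measureReal_def]
    exact ENNReal.toReal_pos (Metric.measure_ball_pos _ _ one_pos).ne' measure_ball_lt_top.ne
  refine ⟨n * c * (4 + 2 ^ (n + 1) * 2), by positivity, ?_⟩
  intro x
  set a := 1 + ‖x‖ ^ 2 with ha
  have ha0 : 0 < a := by positivity
  have hJ : 0 < √a := Real.sqrt_pos.2 ha0
  have hJ2 : √a ^ 2 = a := Real.sq_sqrt ha0.le
  set T := {y : EuclideanSpace ℝ (Fin n) | √a / 2 ≤ ‖y‖} with hT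
  have hTm : MeasurableSet T := measurableSet_le measurable_const measurable_norm
  obtain ⟨ho1, ho2⟩ := hl_outer n hn (√a / 2) (by positivity)
  obtain ⟨hm1, hm2⟩ := hl_mid n hn (√a) hJ
  set B := {y : EuclideanSpace ℝ (Fin n) | ‖y‖ ≤ √a} with hB
  have hBm : MeasurableSet B := measurableSet_le measurable_norm measurable_const
  set w : EuclideanSpace ℝ (Fin n) → ℝ := fun y => (1 + ‖y‖ ^ 2) ^ (-(n : ℝ) / 2) with hw
  have hw0 : ∀ y, 0 ≤ w y := fun y => by positivity
  set H : EuclideanSpace ℝ (Fin n) → ℝ := fun y => B.indicator w (x + y) with hH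
  have hH0 : ∀ y, 0 ≤ H y := fun y => Set.indicator_nonneg (fun z _ => hw0 z) _
  have hHi : Integrable H := ((integrable_indicator_iff hBm).2 hm1).comp_add_left x
  have hHint : ∫ y, H y ≤ n * c * (2 * Real.log (1 + √a)) := by
    rw [hH, integral_add_left_eq_self (B.indicator w) x, integral_indicator hBm]
    exact hm2
  have hHT : ∫ y in T, H y ≤ ∫ y, H y :=
    setIntegral_le_integral hHi (Eventually.of_forall hH0)
  have hbound : ‖∫ y in T, (a ^ (-(n : ℝ) / 2) - w (x + y)) / ‖y‖ ^ (n + 1)‖ ≤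
      ∫ y in T, ((2 * a ^ (-(n : ℝ) / 2)) * (1 / ‖y‖ ^ (n + 1)) +
        ((√a / 2) ^ (n + 1))⁻¹ * H y) := by
    apply norm_integral_le_of_norm_le
    · exact (ho1.const_mul _).add (hHi.integrableOn.const_mul _)
    · filter_upwards [ae_restrict_mem hTm] with y hy
      have hy1 : √a / 2 ≤ ‖y‖ := hy
      have hy0 : 0 < ‖y‖ := lt_of_lt_of_le (by positivity) hy1
      have hwx : 0 ≤ a ^ (-(n : ℝ) / 2) := by positivity
      have hwy := hw0 (x + y)
      rw [norm_div, Real.norm_eq_abs, norm_pow, norm_norm]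
      have t1 : |a ^ (-(n : ℝ) / 2) - w (x + y)| ≤ a ^ (-(n : ℝ) / 2) + w (x + y) := by
        rw [abs_le]; constructor <;> linarith
      have t2 : w (x + y) / ‖y‖ ^ (n + 1) ≤
          a ^ (-(n : ℝ) / 2) / ‖y‖ ^ (n + 1) + ((√a / 2) ^ (n + 1))⁻¹ * H y := by
        by_cases h : x + y ∈ B
        · have : H y = w (x + y) := Set.indicator_of_mem h w
          rw [this]
          have : w (x + y) / ‖y‖ ^ (n + 1) ≤ ((√a / 2) ^ (n + 1))⁻¹ * w (x + y) := by
            rw [div_eq_mul_inv, mul_comm]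
            gcongr
          have h2 : 0 ≤ a ^ (-(n : ℝ) / 2) / ‖y‖ ^ (n + 1) := by positivity
          linarith
        · have : H y = 0 := Set.indicator_of_notMem h w
          rw [this, mul_zero, add_zero]
          have h' : √a < ‖x + y‖ := not_le.1 h
          have h2 : a ≤ 1 + ‖x + y‖ ^ 2 := by
            have : √a ^ 2 ≤ ‖x + y‖ ^ 2 := by gcongr
            rw [hJ2] at this; linarith
          have h3 : w (x + y) ≤ a ^ (-(n : ℝ) / 2) :=
            Real.rpow_le_rpow_of_nonpos ha0 h2 (by linarith)
          gcongr
      calc _ ≤ (a ^ (-(n : ℝ) / 2) + w (x + y)) / ‖y‖ ^ (n + 1) := by gcongr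
        _ = a ^ (-(n : ℝ) / 2) / ‖y‖ ^ (n + 1) + w (x + y) / ‖y‖ ^ (n + 1) := add_div _ _ _
        _ ≤ a ^ (-(n : ℝ) / 2) / ‖y‖ ^ (n + 1) + (a ^ (-(n : ℝ) / 2) / ‖y‖ ^ (n + 1) +
            ((√a / 2) ^ (n + 1))⁻¹ * H y) := by gcongr
        _ = _ := by ring
  rw [integral_add (ho1.const_mul _) (hHi.integrableOn.const_mul _), integral_const_mul,
    integral_const_mul, Real.norm_eq_abs] at hbound
  refine hbound.trans ?_
  set P := a ^ (-((n : ℝ) + 1) / 2) with hP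
  have hP0 : 0 < P := by positivity
  have p1 : a ^ (-(n : ℝ) / 2) * (√a)⁻¹ = P := by
    rw [Real.sqrt_eq_rpow, ← Real.rpow_neg ha0.le, ← Real.rpow_add ha0]; congr 1; ring
  have p2 : ((√a / 2) ^ (n + 1))⁻¹ = 2 ^ (n + 1) * P := by
    have : P = (√a ^ (n + 1))⁻¹ := by
      rw [hP, Real.sqrt_eq_rpow, ← Real.rpow_mul_natCast ha0.le, ← Real.rpow_neg ha0.le]
      congr 1; push_cast; ring
    rw [this, div_pow, inv_div]; rfl
  have hx0 : 0 ≤ ‖x‖ := norm_nonneg x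
  have hJle : √a ≤ 1 + ‖x‖ := by
    rw [Real.sqrt_le_left (by positivity)]; nlinarith
  have hl0 : 0 ≤ Real.log (1 + ‖x‖) := Real.log_nonneg (by linarith)
  have hlog : Real.log (1 + √a) ≤ 1 + Real.log (1 + ‖x‖) := by
    have h1 : Real.log (1 + √a) ≤ Real.log (2 * (1 + ‖x‖)) :=
      Real.log_le_log (by positivity) (by linarith)
    rw [Real.log_mul (by norm_num) (by positivity)] at h1
    have := Real.log_two_lt_d9
    linarith
  set Lg := 1 + Real.log (1 + ‖x‖)
  have hL1 : 1 ≤ Lg := by simp only [Lg]; linarith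
  have b1 : 2 * a ^ (-(n : ℝ) / 2) * ∫ y in T, 1 / ‖y‖ ^ (n + 1) ≤ n * c * 4 * P * Lg := by
    calc _ ≤ 2 * a ^ (-(n : ℝ) / 2) * (n * c * (√a / 2)⁻¹) := by gcongr
      _ = n * c * 4 * P * 1 := by rw [← p1]; field_simp; ring
      _ ≤ _ := by gcongr
  have b2 : ((√a / 2) ^ (n + 1))⁻¹ * ∫ y in T, H y ≤ n * c * (2 ^ (n + 1) * 2) * P * Lg := by
    rw [p2]
    calc _ ≤ 2 ^ (n + 1) * P * (n * c * (2 * Lg)) := by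
          gcongr
          refine (hHT.trans hHint).trans ?_
          gcongr
      _ = _ := by ring
  calc _ ≤ n * c * 4 * P * Lg + n * c * (2 ^ (n + 1) * 2) * P * Lg := add_le_add b1 b2
    _ = _ := by ring

/-- Pointwise bound for the half-Laplacian of the weight `⟨·⟩^{-n}` (critical case `q = n`):
any principal-value limit `L` satisfies `|L| ≤ A ⟨x⟩^{-n-1} (1 + log(1+|x|))`. -/
theorem halfLaplacian_weight_bound_critical (n : ℕ) (hn : 1 ≤ n) :
    ∃ A > (0:ℝ), ∀ (x : EuclideanSpace ℝ (Fin n)) (L : ℝ),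
      Tendsto
        (fun ε : ℝ => ∫ y in {y : EuclideanSpace ℝ (Fin n) | ε ≤ ‖y‖},
          ((1 + ‖x‖ ^ 2) ^ (-(n : ℝ) / 2) - (1 + ‖x + y‖ ^ 2) ^ (-(n : ℝ) / 2)) / ‖y‖ ^ (n + 1))
        (nhdsWithin 0 (Set.Ioi 0)) (nhds L) →
      |L| ≤ A * (1 + ‖x‖ ^ 2) ^ (-((n : ℝ) + 1) / 2) * (1 + Real.log (1 + ‖x‖)) := by
  obtain ⟨K₁, hK₁, h₁⟩ := hl_near n hn
  obtain ⟨K₂, hK₂, h₂⟩ := hl_far n hn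
  refine ⟨K₁ + K₂, by positivity, ?_⟩
  intro x L hL
  refine le_of_tendsto hL.abs ?_
  have hJ : 0 < √(1 + ‖x‖ ^ 2) := Real.sqrt_pos.2 (by positivity)
  have hev : Set.Ioo (0:ℝ) (√(1 + ‖x‖ ^ 2) / 2) ∈ nhdsWithin (0:ℝ) (Set.Ioi 0) :=
    Ioo_mem_nhdsGT (by positivity)
  filter_upwards [hev] with ε hε
  have hset : {y : EuclideanSpace ℝ (Fin n) | ε ≤ ‖y‖} =
      ({y : EuclideanSpace ℝ (Fin n) | ε ≤ ‖y‖} ∩ {y | ‖y‖ < √(1 + ‖x‖ ^ 2) / 2}) ∪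
      {y | √(1 + ‖x‖ ^ 2) / 2 ≤ ‖y‖} := by
    ext y
    change ε ≤ ‖y‖ ↔ (ε ≤ ‖y‖ ∧ ‖y‖ < √(1 + ‖x‖ ^ 2) / 2) ∨ √(1 + ‖x‖ ^ 2) / 2 ≤ ‖y‖
    have := hε.2
    constructor
    · intro h
      rcases lt_or_ge ‖y‖ (√(1 + ‖x‖ ^ 2) / 2) with h' | h'
      · exact Or.inl ⟨h, h'⟩
      · exact Or.inr h'
    · rintro (h | h)
      · exact h.1
      · linarith
  have hint := hl_integrable n hn x ε hε.1
  rw [hset, setIntegral_union ?_ (measurableSet_le measurable_const measurable_norm)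
    (hint.mono_set Set.inter_subset_left)
    (hint.mono_set (fun y (hy : _ ≤ ‖y‖) => (hε.2.le.trans hy : ε ≤ ‖y‖)))]
  · have q1 := h₁ x ε hε.1
    have q2 := h₂ x
    have hx0 : 0 ≤ ‖x‖ := norm_nonneg x
    have hl0 : 0 ≤ Real.log (1 + ‖x‖) := Real.log_nonneg (by linarith)
    refine (abs_add_le _ _).trans ?_
    have q3 : K₁ * (1 + ‖x‖ ^ 2) ^ (-((n : ℝ) + 1) / 2) ≤
        K₁ * (1 + ‖x‖ ^ 2) ^ (-((n : ℝ) + 1) / 2) * (1 + Real.log (1 + ‖x‖)) :=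
      le_mul_of_one_le_right (by positivity) (by linarith)
    calc _ ≤ _ := add_le_add (q1.trans q3) q2
      _ = _ := by ring
  · rw [Set.disjoint_left]
    rintro y ⟨_, hy⟩ hy'
    have h1 : ‖y‖ < √(1 + ‖x‖ ^ 2) / 2 := hy
    have h2 : √(1 + ‖x‖ ^ 2) / 2 ≤ ‖y‖ := hy'
    linarith
end
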